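/- arXiv:1608.02155 — 2 statements merged into one kernel-verified Lean document; each statement's English description precedes it below -/
import Mathlib

section
/- Let q ∈ K satisfy 0 < |q| < 1, and let w ∈ K^× satisfy |q| < |w| < |q|^{1/2}. Then Tate's series x(w) converges and |x(w)| = |q|·|w|⁻¹. -/
noncomputable section

variable (K : Type) [NontriviallyNormedField K] [IsUltrametricDist K]

/-- The `m`-th term (`m ≥ 1`) of Tate's series `x(w)` with parameter `q`. -/
def tateTerm (q w : K) (m : ℕ) : K :=
  q ^ m * w / (1 - q ^ m * w) ^ 2 + q ^ m * w⁻¹ / (1 - q ^ m * w⁻¹) ^ 2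
    - 2 * (q ^ m / (1 - q ^ m) ^ 2)

/-- Tate's series `x(w)` for the Tate curve with parameter `q`. -/
def xTate (q w : K) : K :=
  w / (1 - w) ^ 2 + ∑' m : ℕ, tateTerm K q w (m + 1)

theorem norm_sub_le_max_norm {E : Type*} [SeminormedAddCommGroup E] [IsUltrametricDist E]
    (x y : E) : ‖x - y‖ ≤ max ‖x‖ ‖y‖ := by
  simpa [sub_eq_add_neg] using IsUltrametricDist.norm_add_le_max x (-y)

theorem norm_div_one_sub_sq {F : Type*} [NormedField F] [IsUltrametricDist F]
    {x : F} (hx : ‖x‖ < 1) : ‖x / (1 - x) ^ 2‖ = ‖x‖ := by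
  have h : ‖1 - x‖ = 1 := by
    have h1 : ‖(1 : F)‖ ≠ ‖-x‖ := by rw [norm_one, norm_neg]; exact hx.ne'
    rw [sub_eq_add_neg, IsUltrametricDist.norm_add_eq_max_of_norm_ne_norm h1, norm_one,
      norm_neg, max_eq_left hx.le]
  rw [norm_div, norm_pow, h, one_pow, div_one]

theorem norm_two_mul_le {F : Type*} [NormedField F] [IsUltrametricDist F] (x : F) :
    ‖2 * x‖ ≤ ‖x‖ := by
  rw [two_mul]
  exact (IsUltrametricDist.norm_add_le_max x x).trans_eq (max_self _)

theorem norm_tateTerm_le {F : Type} [NontriviallyNormedField F] [IsUltrametricDist F]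
    {q w : F} (hq1 : ‖q‖ < 1) (hw0 : w ≠ 0) (hlo : ‖q‖ < ‖w‖) (hw1 : ‖w‖ < 1) (m : ℕ) :
    ‖tateTerm F q w (m + 1)‖ ≤ ‖q‖ ^ m * (‖q‖ * ‖w‖⁻¹) := by
  have hw : 0 < ‖w‖ := norm_pos_iff.mpr hw0
  have hqm : ‖q ^ (m + 1)‖ ≤ ‖q‖ := by
    rw [norm_pow]
    exact pow_le_of_le_one (norm_nonneg q) hq1.le m.succ_ne_zero
  have hinv : 1 ≤ ‖w‖⁻¹ := (one_le_inv₀ hw).mpr hw1.le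
  have hqw : ‖q ^ (m + 1) * w‖ < 1 := by
    rw [norm_mul]
    exact mul_lt_one_of_nonneg_of_lt_one_left (norm_nonneg _) (hqm.trans_lt hq1) hw1.le
  have hqw' : ‖q ^ (m + 1) * w⁻¹‖ < 1 := by
    rw [norm_mul, norm_inv, ← div_eq_mul_inv, div_lt_one hw]
    exact hqm.trans_lt hlo
  have hr : ‖q‖ ^ m * (‖q‖ * ‖w‖⁻¹) = ‖q ^ (m + 1)‖ * ‖w‖⁻¹ := by
    rw [norm_pow]; ring
  rw [hr, tateTerm]
  refine (norm_sub_le_max_norm _ _).trans (max_le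
    ((IsUltrametricDist.norm_add_le_max _ _).trans (max_le ?_ ?_)) ?_)
  · rw [norm_div_one_sub_sq hqw, norm_mul]
    gcongr
    exact hw1.le.trans hinv
  · rw [norm_div_one_sub_sq hqw', norm_mul, norm_inv]
  · refine (norm_two_mul_le _).trans ?_
    rw [norm_div_one_sub_sq (hqm.trans_lt hq1)]
    exact le_mul_of_one_le_right (norm_nonneg _) hinv

/-- For `0 < |q| < 1` and `w ∈ K^×` with `|q| < |w| < |q|^{1/2}`, Tate's series
`x(w)` converges and `|x(w)| = |q|·|w|⁻¹`. -/
theorem tate_series_norm_inner {K : Type} [NontriviallyNormedField K] [IsAlgClosed K]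
    [CompleteSpace K] [IsUltrametricDist K] (q : K) (hq0 : q ≠ 0) (hq1 : ‖q‖ < 1)
    (w : K) (hw0 : w ≠ 0) (hlo : ‖q‖ < ‖w‖) (hhi : ‖w‖ < Real.sqrt ‖q‖) :
    Summable (fun m : ℕ => tateTerm K q w (m + 1)) ∧ ‖xTate K q w‖ = ‖q‖ * ‖w‖⁻¹ := by
  have hq : 0 < ‖q‖ := norm_pos_iff.mpr hq0
  have hw : 0 < ‖w‖ := norm_pos_iff.mpr hw0
  have hsq : ‖w‖ ^ 2 < ‖q‖ := (Real.lt_sqrt hw.le).mp hhi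
  have hw1 : ‖w‖ < 1 := by nlinarith
  have hle := norm_tateTerm_le hq1 hw0 hlo hw1
  have hr : 0 < ‖q‖ * ‖w‖⁻¹ := by positivity
  have hqr : ‖q‖ < ‖q‖ * ‖w‖⁻¹ := lt_mul_of_one_lt_right hq ((one_lt_inv₀ hw).mpr hw1)
  have hsum : Summable (fun m : ℕ => tateTerm K q w (m + 1)) :=
    Summable.of_norm_bounded
      ((summable_geometric_of_lt_one hq.le hq1).mul_right (‖q‖ * ‖w‖⁻¹)) hle
  refine ⟨hsum, ?_⟩
  have hmain : ‖q * w⁻¹ / (1 - q * w⁻¹) ^ 2‖ = ‖q‖ * ‖w‖⁻¹ := by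
    rw [norm_div_one_sub_sq, norm_mul, norm_inv]
    rwa [norm_mul, norm_inv, ← div_eq_mul_inv, div_lt_one hw]
  have hw_lt : ‖w / (1 - w) ^ 2‖ < ‖q‖ * ‖w‖⁻¹ := by
    rw [norm_div_one_sub_sq hw1, ← div_eq_mul_inv, lt_div_iff₀ hw, ← sq]
    exact hsq
  have hqw_lt : ‖q * w / (1 - q * w) ^ 2‖ < ‖q‖ * ‖w‖⁻¹ := by
    have h : ‖q * w‖ < ‖q‖ := by
      rw [norm_mul]
      exact mul_lt_of_lt_one_right hq hw1
    rw [norm_div_one_sub_sq (h.trans hq1)]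
    exact h.trans hqr
  have hq_lt : ‖2 * (q / (1 - q) ^ 2)‖ < ‖q‖ * ‖w‖⁻¹ := by
    refine (norm_two_mul_le _).trans_lt ?_
    rwa [norm_div_one_sub_sq hq1]
  have htail : ‖∑' m : ℕ, tateTerm K q w (m + 1 + 1)‖ < ‖q‖ * ‖w‖⁻¹ := by
    refine lt_of_le_of_lt (IsUltrametricDist.norm_tsum_le_of_forall_le_of_nonneg
      (C := ‖q‖ * (‖q‖ * ‖w‖⁻¹)) (by positivity) fun m => (hle (m + 1)).trans ?_)
      (mul_lt_of_lt_one_left hr hq1)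
    gcongr
    exact pow_le_of_le_one hq.le hq1.le m.succ_ne_zero
  have hrest : ‖w / (1 - w) ^ 2 + q * w / (1 - q * w) ^ 2 - 2 * (q / (1 - q) ^ 2)
      + ∑' m : ℕ, tateTerm K q w (m + 1 + 1)‖ < ‖q‖ * ‖w‖⁻¹ :=
    (IsUltrametricDist.norm_add_le_max _ _).trans_lt (max_lt
      ((norm_sub_le_max_norm _ _).trans_lt (max_lt
        ((IsUltrametricDist.norm_add_le_max _ _).trans_lt (max_lt hw_lt hqw_lt)) hq_lt)) htail)
  have hsplit : xTate K q w = q * w⁻¹ / (1 - q * w⁻¹) ^ 2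
      + (w / (1 - w) ^ 2 + q * w / (1 - q * w) ^ 2 - 2 * (q / (1 - q) ^ 2)
        + ∑' m : ℕ, tateTerm K q w (m + 1 + 1)) := by
    rw [xTate, hsum.tsum_eq_zero_add, zero_add, tateTerm, pow_one]
    ring
  rw [hsplit, IsUltrametricDist.norm_add_eq_max_of_norm_ne_norm (by rw [hmain]; exact hrest.ne'),
    hmain, max_eq_left hrest.le]

end
end

section
/- Assume char(K) ∉ {2,3} and the residue field k has characteristic ∉ {2,3}. Let q ∈ K with 0 < |q| < 1, let m ≥ 2 be an integer, and suppose ψ_m ∈ K(z) is a rational map of degree m² satisfying the semiconjugacy ψ_m(x(w)) = x(w^m) for all w ∈ K^× with w ∉ q^ℤ and w^m ∉ q^ℤ, where x is Tate's series for the parameter q. Then the resultant of a normalized homogeneous lift of ψ_m satisfies R_{ψ_m} = (m²(m²−1)/6) · ord(q). -/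
open MvPolynomial Matrix

noncomputable section

variable {R : Type*} [CommRing R]

def coeffVec (e : ℕ) (F : MvPolynomial (Fin 2) R) (i : Fin (e + 1)) : R :=
  MvPolynomial.coeff (Finsupp.single 0 (e - (i : ℕ)) + Finsupp.single 1 (i : ℕ)) F

def sylv (e : ℕ) (a b : Fin (e + 1) → R) : Matrix (Fin (e + e)) (Fin (e + e)) R :=
  Matrix.of fun i j =>
    if h : (i : ℕ) < e then
      if hj : (i : ℕ) ≤ (j : ℕ) ∧ (j : ℕ) ≤ (i : ℕ) + e then
        a ⟨(j : ℕ) - (i : ℕ), by omega⟩ else 0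
    else
      if hj : (i : ℕ) - e ≤ (j : ℕ) ∧ (j : ℕ) ≤ (i : ℕ) then
        b ⟨(j : ℕ) - ((i : ℕ) - e), by omega⟩ else 0

def bres (e : ℕ) (F G : MvPolynomial (Fin 2) R) : R :=
  (sylv e (coeffVec e F) (coeffVec e G)).det

def comp2 (F f g : MvPolynomial (Fin 2) R) : MvPolynomial (Fin 2) R :=
  MvPolynomial.aeval ![f, g] F

def pairIter (F G : MvPolynomial (Fin 2) R) : ℕ → MvPolynomial (Fin 2) R × MvPolynomial (Fin 2) R
  | 0 => (X 0, X 1)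
  | n + 1 => (comp2 F (pairIter F G n).1 (pairIter F G n).2,
              comp2 G (pairIter F G n).1 (pairIter F G n).2)

variable (K : Type) [NontriviallyNormedField K] [IsUltrametricDist K]

def ordv (x : K) : ℝ := -Real.log ‖x‖

def intRing : Subring K where
  carrier := {x : K | ‖x‖ ≤ 1}
  one_mem' := by simp
  zero_mem' := by simp
  mul_mem' := by
    intro a b ha hb
    simp only [Set.mem_setOf_eq] at *
    calc ‖a * b‖ = ‖a‖ * ‖b‖ := norm_mul a b
    _ ≤ 1 * 1 := by gcongr
    _ = 1 := by ring
  add_mem' := by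
    intro a b ha hb
    simp only [Set.mem_setOf_eq] at *
    exact (IsUltrametricDist.norm_add_le_max a b).trans (max_le ha hb)
  neg_mem' := by
    intro a ha
    simp only [Set.mem_setOf_eq, norm_neg] at *
    exact ha

def maxIdl : Ideal (intRing K) where
  carrier := {x | ‖(x : K)‖ < 1}
  zero_mem' := by simp
  add_mem' := by
    intro a b ha hb
    simp only [Set.mem_setOf_eq] at *
    exact lt_of_le_of_lt (IsUltrametricDist.norm_add_le_max (a : K) b) (max_lt ha hb)
  smul_mem' := by
    intro c x hx
    simp only [Set.mem_setOf_eq] at *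
    calc ‖((c • x : intRing K) : K)‖ = ‖(c : K)‖ * ‖(x : K)‖ := norm_mul _ _
    _ ≤ 1 * ‖(x : K)‖ := by gcongr; exact c.2
    _ < 1 := by simpa using hx

def kk := intRing K ⧸ maxIdl K

instance : CommRing (kk K) := Ideal.Quotient.commRing (maxIdl K)

def redCoeff (x : K) : kk K :=
  if h : ‖x‖ ≤ 1 then Ideal.Quotient.mk (maxIdl K) ⟨x, h⟩ else 0

def redPoly (F : MvPolynomial (Fin 2) K) : MvPolynomial (Fin 2) (kk K) :=
  ∑ m ∈ F.support, MvPolynomial.monomial m (redCoeff K (F.coeff m))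

/-- A pair of binary forms is a (homogeneous) lift of a degree-`d` rational map if both entries
are homogeneous of degree `d` and they are coprime. -/
def LiftPair (d : ℕ) (F G : MvPolynomial (Fin 2) K) : Prop :=
  F.IsHomogeneous d ∧ G.IsHomogeneous d ∧ IsRelPrime F G

/-- A pair of binary forms is normalized if all coefficients lie in `O`
and some coefficient has absolute value `1`. -/
def Normalized (F G : MvPolynomial (Fin 2) K) : Prop :=
  (∀ m, ‖F.coeff m‖ ≤ 1) ∧ (∀ m, ‖G.coeff m‖ ≤ 1) ∧
    (∃ m, ‖F.coeff m‖ = 1 ∨ ‖G.coeff m‖ = 1)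

/-- The maximum of the absolute values of the coefficients of a pair of degree-`e` binary forms. -/
def maxNorm (e : ℕ) (F G : MvPolynomial (Fin 2) K) : ℝ :=
  Finset.univ.sup' Finset.univ_nonempty
    (fun i : Fin (e + 1) => max ‖coeffVec e F i‖ ‖coeffVec e G i‖)

/-- `Rpair e F G` is the quantity `R_φ = ord(Res(F₀,G₀))` where `(F₀,G₀)` is the normalized
rescaling of the pair `(F,G)` of degree-`e` binary forms; equivalently it is
`ord(Res(F,G)) - 2·e·(minimal ord of a coefficient of F, G)`. -/
def Rpair (e : ℕ) (F G : MvPolynomial (Fin 2) K) : ℝ :=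
  ordv K (bres e F G) + 2 * e * Real.log (maxNorm K e F G)

/-- Linear substitution of a `2×2` matrix into a binary form. -/
def mobius (M : Matrix (Fin 2) (Fin 2) K) (F : MvPolynomial (Fin 2) K) :
    MvPolynomial (Fin 2) K :=
  MvPolynomial.aeval
    ![C (M 0 0) * X 0 + C (M 0 1) * X 1, C (M 1 0) * X 0 + C (M 1 1) * X 1] F

/-- The conjugate pair `γ⁻¹ ∘ (F,G) ∘ γ`, a homogeneous lift of `φ^γ = γ⁻¹ ∘ φ ∘ γ`. -/
def conjPair (M : GL (Fin 2) K) (F G : MvPolynomial (Fin 2) K) :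
    MvPolynomial (Fin 2) K × MvPolynomial (Fin 2) K :=
  (C ((M⁻¹ : GL (Fin 2) K) 0 0) * mobius K M F + C ((M⁻¹ : GL (Fin 2) K) 0 1) * mobius K M G,
   C ((M⁻¹ : GL (Fin 2) K) 1 0) * mobius K M F + C ((M⁻¹ : GL (Fin 2) K) 1 1) * mobius K M G)

/-- The minimal resultant `R_{[φ]} = inf_γ R_{φ^γ}` of (the map lifted by) a degree-`e` pair. -/
def Rmin (e : ℕ) (F G : MvPolynomial (Fin 2) K) : ℝ :=
  ⨅ M : GL (Fin 2) K, Rpair K e (conjPair K M F G).1 (conjPair K M F G).2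

/-- `Ilocus d F G` says the reduction of the normalized pair `(F,G)` lies in the indeterminacy
locus `I(d)`: the reduced pair is proportional, i.e. `(F̃, G̃) = (a·C, b·C)` with `[a:b] ∈ P¹(k)`
(so that the residue map is the constant `[a:b]`), and the constant value `[a:b]`
is a root of the common factor `C` (which is the gcd `Ã` of `F̃` and `G̃`). -/
def Ilocus (d : ℕ) (F G : MvPolynomial (Fin 2) K) : Prop :=
  ∃ (a b : kk K) (Cf : MvPolynomial (Fin 2) (kk K)),
    ¬(a = 0 ∧ b = 0) ∧ Cf.IsHomogeneous d ∧
    redPoly K F = MvPolynomial.C a * Cf ∧ redPoly K G = MvPolynomial.C b * Cf ∧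
    MvPolynomial.eval ![a, b] Cf = 0

/-- `Semistable d F G` says the reduction of the normalized pair `(F,G)` is GIT-semistable
(Silverman's numerical criterion): writing `F̃ = Ã·F̃₀`, `G̃ = Ã·G̃₀` with `F̃₀, G̃₀` coprime,
every root `h = [a:b]` of `Ã` has multiplicity `r ≤ d/2` (`d` even), resp. `r ≤ (d+1)/2`
(`d` odd), and when the bound is attained additionally `φ̃(h) ≠ h`. -/
def Semistable (d : ℕ) (F G : MvPolynomial (Fin 2) K) : Prop :=
  ∃ (A F0 G0 : MvPolynomial (Fin 2) (kk K)) (e : ℕ),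
    e ≤ d ∧ A.IsHomogeneous (d - e) ∧ F0.IsHomogeneous e ∧ G0.IsHomogeneous e ∧
    redPoly K F = A * F0 ∧ redPoly K G = A * G0 ∧ IsRelPrime F0 G0 ∧
    ∀ (a b : kk K), ¬(a = 0 ∧ b = 0) → ∀ r : ℕ,
      (MvPolynomial.C b * X 0 - MvPolynomial.C a * X 1) ^ r ∣ A →
        2 * r ≤ d + 1 ∧
          (d ≤ 2 * r →
            b * MvPolynomial.eval ![a, b] F0 ≠ a * MvPolynomial.eval ![a, b] G0)

/-- The rational map lifted by the (not necessarily normalized) pair `(F,G)` has semistable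
reduction: some normalized rescaling is `Semistable`. -/
def HasSemistableRed (d : ℕ) (F G : MvPolynomial (Fin 2) K) : Prop :=
  ∃ c : Kˣ, Normalized K ((c : K) • F) ((c : K) • G) ∧
    Semistable K d ((c : K) • F) ((c : K) • G)

/-- The reduction of (a normalized rescaling of) the pair `(F,G)` lies outside `I(d)`. -/
def RedOutsideI (d : ℕ) (F G : MvPolynomial (Fin 2) K) : Prop :=
  ∃ c : Kˣ, Normalized K ((c : K) • F) ((c : K) • G) ∧
    ¬ Ilocus K d ((c : K) • F) ((c : K) • G)

section

variable {L : Type} [NontriviallyNormedField L]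

lemma exists_homogenize_eq {d : ℕ} {F : MvPolynomial (Fin 2) L} (hF : F.IsHomogeneous d) :
    ∃ f : Polynomial L, f.natDegree ≤ d ∧ f.homogenize d = F := by
  refine ⟨∑ i ∈ Finset.range (d + 1), Polynomial.C
    (F.coeff (Finsupp.single 0 i + Finsupp.single 1 (d - i))) * Polynomial.X ^ i, ?_, ?_⟩
  · refine Polynomial.natDegree_sum_le_of_forall_le _ _ fun i hi => ?_
    exact (Polynomial.natDegree_C_mul_X_pow_le _ _).trans (by simpa [Nat.lt_succ_iff] using hi)
  · ext e
    rw [Polynomial.coeff_homogenize]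
    split_ifs with h
    · simp only [Polynomial.finsetSum_coeff, Polynomial.coeff_C_mul, Polynomial.coeff_X_pow,
        mul_ite, mul_one, mul_zero, Finset.sum_ite_eq, Finset.mem_range]
      rw [if_pos (by omega)]
      congr 1
      ext i
      fin_cases i
      · simp
      · simp; omega
    · by_contra hne
      refine h ?_
      have := hF (Ne.symm hne)
      simpa [Finsupp.weight_apply, Finsupp.sum_fintype, Fin.sum_univ_two] using this

lemma coeffVec_homogenize (d : ℕ) (f : Polynomial L) (i : Fin (d + 1)) :
    coeffVec d (f.homogenize d) i = f.coeff (d - i) := by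
  rw [coeffVec, Polynomial.coeff_homogenize]
  have : (i : ℕ) ≤ d := Nat.lt_succ_iff.mp i.2
  simp [this]

lemma bres_homogenize (d : ℕ) (f g : Polynomial L) :
    bres d (f.homogenize d) (g.homogenize d) = Polynomial.resultant f g d d := by
  have h : sylv d (coeffVec d (f.homogenize d)) (coeffVec d (g.homogenize d)) =
      ((Polynomial.sylvester f g d d)ᵀ).submatrix Fin.revPerm Fin.revPerm := by
    ext i j
    simp only [sylv, of_apply, submatrix_apply, transpose_apply, Fin.revPerm_apply,
      coeffVec_homogenize, Polynomial.sylvester]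
    have hj := j.2
    have hi := i.2
    obtain ⟨k, hk⟩ : ∃ k, Fin.rev i = k := ⟨_, rfl⟩
    have hkv : (k : ℕ) = d + d - (i + 1) := by rw [← hk, Fin.val_rev]
    rw [hk]
    induction k using Fin.addCases with
    | left k =>
      have := k.2
      simp only [Fin.val_castAdd] at hkv
      simp only [Fin.addCases_left, Fin.val_rev, Set.mem_Icc]
      rw [dif_neg (by omega)]
      split_ifs with h1 h2 h2
      · congr 1; omega
      · omega
      · omega
      · rfl
    | right k =>
      have := k.2
      simp only [Fin.val_natAdd] at hkv
      simp only [Fin.addCases_right, Fin.val_rev, Set.mem_Icc]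
      rw [dif_pos (by omega)]
      split_ifs with h1 h2 h2
      · congr 1; omega
      · omega
      · omega
      · rfl
  rw [bres, h, det_submatrix_equiv_self, det_transpose, Polynomial.resultant]

lemma maxNorm_homogenize_eq_one {d : ℕ} {f g : Polynomial L}
    (h : Normalized L (f.homogenize d) (g.homogenize d)) :
    maxNorm L d (f.homogenize d) (g.homogenize d) = 1 := by
  obtain ⟨hF, hG, e, he⟩ := h
  refine le_antisymm (Finset.sup'_le _ _ fun i _ => max_le (hF _) (hG _)) ?_
  have hed : e 0 + e 1 = d := by
    by_contra hne
    simp [Polynomial.coeff_homogenize, hne] at he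
  have hee : Finsupp.single 0 (d - e 1) + Finsupp.single 1 (e 1) = e := by
    ext i
    fin_cases i
    · simp; omega
    · simp
  refine le_trans ?_ (Finset.le_sup' (fun i : Fin (d + 1) =>
    max ‖coeffVec d (f.homogenize d) i‖ ‖coeffVec d (g.homogenize d) i‖)
    (Finset.mem_univ (⟨e 1, by omega⟩ : Fin (d + 1))))
  simp only [coeffVec, hee, le_max_iff]
  exact he.imp ge_of_eq ge_of_eq

lemma exists_norm_eq_rpow [IsAlgClosed L] {q : L} (hq0 : q ≠ 0) (t : ℚ) :
    ∃ w : L, w ≠ 0 ∧ ‖w‖ = ‖q‖ ^ (t : ℝ) := by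
  obtain ⟨y, hy⟩ := IsAlgClosed.exists_pow_nat_eq q t.den_pos
  have hy0 : y ≠ 0 := by
    rintro rfl
    rw [zero_pow t.den_nz] at hy
    exact hq0 hy.symm
  refine ⟨y ^ t.num, zpow_ne_zero _ hy0, ?_⟩
  have hd : (t.den : ℝ) ≠ 0 := by exact_mod_cast t.den_nz
  rw [← hy, norm_zpow, norm_pow, ← Real.rpow_natCast, ← Real.rpow_mul (norm_nonneg _),
    ← Real.rpow_intCast]
  congr 1
  have := Rat.cast_def (K := ℝ) t
  rw [this]
  field_simp

lemma norm_sub_le_max_norm_s12 [IsUltrametricDist L] (a b : L) : ‖a - b‖ ≤ max ‖a‖ ‖b‖ := by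
  rw [sub_eq_add_neg, ← norm_neg b]
  exact IsUltrametricDist.norm_add_le_max _ _

lemma norm_sub_eq_max_norm [IsUltrametricDist L] {a b : L} (h : ‖a‖ ≠ ‖b‖) :
    ‖a - b‖ = max ‖a‖ ‖b‖ := by
  rw [sub_eq_add_neg, ← norm_neg b]
  exact IsUltrametricDist.norm_add_eq_max_of_norm_ne_norm (by rwa [norm_neg])

lemma norm_one_sub_of_lt [IsUltrametricDist L] {y : L} (hy : ‖y‖ < 1) : ‖1 - y‖ = 1 := by
  rw [norm_sub_eq_max_norm (by rw [norm_one]; exact hy.ne'),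
    norm_one, max_eq_left hy.le]

lemma norm_one_sub_of_gt [IsUltrametricDist L] {y : L} (hy : 1 < ‖y‖) : ‖1 - y‖ = ‖y‖ := by
  rw [norm_sub_eq_max_norm (by rw [norm_one]; exact hy.ne),
    norm_one, max_eq_right hy.le]

lemma norm_div_one_sub_sq_s12 [IsUltrametricDist L] {y : L} {Q t : ℝ} (hQ0 : 0 < Q) (hQ1 : Q < 1)
    (hy : ‖y‖ = Q ^ t) (ht : t ≠ 0) : ‖y / (1 - y) ^ 2‖ = Q ^ |t| := by
  rcases lt_or_gt_of_ne ht with h | h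
  · have h1 : 1 < ‖y‖ := hy ▸ Real.one_lt_rpow_of_pos_of_lt_one_of_neg hQ0 hQ1 h
    rw [norm_div, norm_pow, norm_one_sub_of_gt h1, hy, abs_of_neg h, Real.rpow_neg hQ0.le]
    have := (Real.rpow_pos_of_pos hQ0 t).ne'
    field_simp
  · have h1 : ‖y‖ < 1 := hy ▸ Real.rpow_lt_one hQ0.le hQ1 h
    rw [norm_div, norm_pow, norm_one_sub_of_lt h1, hy, abs_of_pos h]
    simp

/-- The three summands of a term of Tate's series, for `w` of non-integral valuation `t > 0`. -/
lemma norm_tateTerm_parts [IsUltrametricDist L] {q w : L} (hq0 : q ≠ 0) (hq1 : ‖q‖ < 1) {t : ℝ}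
    (ht : 0 < t) (hw : ‖w‖ = ‖q‖ ^ t) {k : ℕ} (hk : 0 < k) (hkt : (k : ℝ) ≠ t) :
    ‖q ^ k * w / (1 - q ^ k * w) ^ 2‖ = ‖q‖ ^ ((k : ℝ) + t) ∧
    ‖q ^ k * w⁻¹ / (1 - q ^ k * w⁻¹) ^ 2‖ = ‖q‖ ^ |(k : ℝ) - t| ∧
    ‖2 * (q ^ k / (1 - q ^ k) ^ 2)‖ ≤ ‖q‖ ^ (k : ℝ) := by
  have hQ0 : 0 < ‖q‖ := norm_pos_iff.mpr hq0
  have hk' : (0 : ℝ) < k := by exact_mod_cast hk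
  refine ⟨?_, ?_, ?_⟩
  · rw [norm_div_one_sub_sq_s12 (t := k + t) hQ0 hq1 _ (by positivity), abs_of_pos (by positivity)]
    rw [norm_mul, norm_pow, hw, Real.rpow_add hQ0, Real.rpow_natCast]
  · refine norm_div_one_sub_sq_s12 hQ0 hq1 ?_ (sub_ne_zero.mpr hkt)
    rw [norm_mul, norm_pow, norm_inv, hw, Real.rpow_sub hQ0, Real.rpow_natCast, div_eq_mul_inv]
  · have h2 : ‖(2 : L)‖ ≤ 1 := by exact_mod_cast IsUltrametricDist.norm_natCast_le_one L 2
    rw [norm_mul, norm_div_one_sub_sq_s12 (t := k) hQ0 hq1 (by rw [norm_pow, Real.rpow_natCast])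
      hk'.ne', abs_of_pos hk']
    exact mul_le_of_le_one_left (by positivity) h2

lemma norm_tateTerm_le_s12 [IsUltrametricDist L] {q w : L} (hq0 : q ≠ 0) (hq1 : ‖q‖ < 1) {t : ℝ}
    (ht : 0 < t) (hw : ‖w‖ = ‖q‖ ^ t) {k : ℕ} (hk : 0 < k) (hkt : (k : ℝ) ≠ t) {c : ℝ}
    (hc : c ≤ k) (hc' : c ≤ |(k : ℝ) - t|) : ‖tateTerm L q w k‖ ≤ ‖q‖ ^ c := by
  have hQ0 : 0 < ‖q‖ := norm_pos_iff.mpr hq0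
  obtain ⟨h1, h2, h3⟩ := norm_tateTerm_parts hq0 hq1 ht hw hk hkt
  have mono : ∀ {a : ℝ}, c ≤ a → ‖q‖ ^ a ≤ ‖q‖ ^ c := fun h =>
    Real.rpow_le_rpow_of_exponent_ge hQ0 hq1.le h
  refine (norm_sub_le_max_norm_s12 _ _).trans (max_le ?_ (h3.trans (mono hc)))
  refine (IsUltrametricDist.norm_add_le_max _ _).trans (max_le ?_ ?_)
  · exact h1.le.trans (mono (by linarith))
  · exact h2.le.trans (mono hc')

lemma summable_tateTerm [CompleteSpace L] [IsUltrametricDist L] {q w : L} (hq0 : q ≠ 0)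
    (hq1 : ‖q‖ < 1) {t : ℝ} (ht : 0 < t) (hw : ‖w‖ = ‖q‖ ^ t) :
    Summable fun k : ℕ => tateTerm L q w (k + 1) := by
  have hQ0 : 0 < ‖q‖ := norm_pos_iff.mpr hq0
  have hs : Summable fun k : ℕ => ‖q‖ ^ (1 - t) * ‖q‖ ^ k :=
    (summable_geometric_of_lt_one hQ0.le hq1).mul_left _
  refine Summable.of_norm_bounded_eventually_nat hs ?_
  filter_upwards [Filter.eventually_gt_atTop ⌈t⌉₊] with k hk
  have hkt : t < k := (Nat.le_ceil t).trans_lt (by exact_mod_cast hk)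
  have := norm_tateTerm_le_s12 hq0 hq1 ht hw (k := k + 1) (c := 1 - t + k) k.succ_pos
    (by push_cast; linarith) (by push_cast; linarith)
    (by push_cast; exact le_trans (by linarith) (le_abs_self _))
  rwa [Real.rpow_add hQ0, Real.rpow_natCast] at this

lemma ne_natCast_of_abs_sub {t : ℝ} {n : ℕ} (hn0 : 0 < |t - n|) (hn : |t - n| < 1 / 2) (k : ℤ) :
    (k : ℝ) ≠ t := by
  rintro rfl
  have h : |k - (n : ℤ)| < 1 := by
    have : (|k - (n : ℤ)| : ℤ) < (1 : ℝ) := by push_cast; linarith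
    exact_mod_cast this
  have h0 : k - (n : ℤ) = 0 := Int.abs_lt_one_iff.mp h
  have : (k : ℝ) - n = 0 := by exact_mod_cast h0
  simp [this] at hn0

lemma half_le_abs_sub {t : ℝ} {n k : ℕ} (hn : |t - n| < 1 / 2) (hkn : k ≠ n) :
    1 / 2 ≤ |(k : ℝ) - t| := by
  have h1 : (1 : ℝ) ≤ |(k : ℝ) - n| := by
    have : (1 : ℤ) ≤ |(k : ℤ) - n| := Int.one_le_abs (by omega)
    exact_mod_cast this
  have := abs_sub_le (k : ℝ) t n
  linarith

/-- The absolute value of Tate's series at a point of valuation `t > 0` (normalized so that `q` has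
valuation `1`) is governed by the distance from `t` to the nearest integer. -/
lemma norm_xTate [CompleteSpace L] [IsUltrametricDist L] {q w : L} (hq0 : q ≠ 0)
    (hq1 : ‖q‖ < 1) {t : ℝ} (ht : 0 < t) (hw : ‖w‖ = ‖q‖ ^ t) {n : ℕ} (hn0 : 0 < |t - n|)
    (hn : |t - n| < 1 / 2) : ‖xTate L q w‖ = ‖q‖ ^ |t - n| := by
  have hQ0 : 0 < ‖q‖ := norm_pos_iff.mpr hq0
  have hlt : ‖q‖ ^ (1 / 2 : ℝ) < ‖q‖ ^ |t - n| := Real.rpow_lt_rpow_of_exponent_gt hQ0 hq1 hn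
  have mono : ∀ {a : ℝ}, 1 / 2 ≤ a → ‖q‖ ^ a ≤ ‖q‖ ^ (1 / 2 : ℝ) := fun h =>
    Real.rpow_le_rpow_of_exponent_ge hQ0 hq1.le h
  have hnat : ∀ k : ℕ, (k : ℝ) ≠ t := fun k => by
    exact_mod_cast ne_natCast_of_abs_sub hn0 hn k
  have hw1 : ‖w / (1 - w) ^ 2‖ = ‖q‖ ^ t := by
    rw [norm_div_one_sub_sq_s12 hQ0 hq1 hw ht.ne', abs_of_pos ht]
  have hterm : ∀ k : ℕ, k + 1 ≠ n → ‖tateTerm L q w (k + 1)‖ ≤ ‖q‖ ^ (1 / 2 : ℝ) := fun k hk =>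
    norm_tateTerm_le_s12 hq0 hq1 ht hw k.succ_pos (hnat _)
      (by push_cast; linarith [(Nat.cast_nonneg k : (0 : ℝ) ≤ k)]) (half_le_abs_sub hn hk)
  suffices h : ∃ a b : L, xTate L q w = a + b ∧ ‖a‖ = ‖q‖ ^ |t - n| ∧
      ‖b‖ ≤ ‖q‖ ^ (1 / 2 : ℝ) by
    obtain ⟨a, b, hab, ha, hb⟩ := h
    have hba : ‖b‖ < ‖a‖ := ha ▸ hb.trans_lt hlt
    rw [hab, IsUltrametricDist.norm_add_eq_max_of_norm_ne_norm hba.ne', max_eq_left hba.le, ha]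
  rcases n with _ | n
  · refine ⟨_, _, rfl, ?_, ?_⟩
    · rw [hw1, Nat.cast_zero, sub_zero, abs_of_pos ht]
    · exact IsUltrametricDist.norm_tsum_le_of_forall_le_of_nonneg (by positivity)
        fun k => hterm k (by omega)
  · have hn1 : (1 : ℝ) ≤ ((n + 1 : ℕ) : ℝ) := by exact_mod_cast Nat.le_add_left 1 n
    obtain ⟨h1, h2, h3⟩ := norm_tateTerm_parts hq0 hq1 ht hw n.succ_pos (hnat (n + 1))
    have ht2 : 1 / 2 ≤ t := by have := (abs_lt.mp hn).1; linarith
    refine ⟨q ^ (n + 1) * w⁻¹ / (1 - q ^ (n + 1) * w⁻¹) ^ 2,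
      w / (1 - w) ^ 2 + (q ^ (n + 1) * w / (1 - q ^ (n + 1) * w) ^ 2
        - 2 * (q ^ (n + 1) / (1 - q ^ (n + 1)) ^ 2)) +
        ∑' k : ℕ, if k = n then 0 else tateTerm L q w (k + 1), ?_, ?_, ?_⟩
    · rw [xTate, (summable_tateTerm hq0 hq1 ht hw).tsum_eq_add_tsum_ite n]
      conv_lhs => rw [tateTerm]
      ring
    · rw [h2, abs_sub_comm]
    · refine (IsUltrametricDist.norm_add_le_max _ _).trans (max_le ?_ ?_)
      · refine (IsUltrametricDist.norm_add_le_max _ _).trans (max_le (hw1 ▸ mono ht2) ?_)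
        refine (norm_sub_le_max_norm_s12 _ _).trans (max_le ?_ ?_)
        · exact h1.le.trans (mono (by linarith))
        · exact h3.trans (mono (by linarith))
      · refine IsUltrametricDist.norm_tsum_le_of_forall_le_of_nonneg (by positivity) fun k => ?_
        split_ifs with hk
        · simp only [norm_zero]; positivity
        · exact hterm k (by omega)

lemma norm_ne_zpow {q w : L} (hq0 : q ≠ 0) (hq1 : ‖q‖ < 1) {t : ℝ} (hw : ‖w‖ = ‖q‖ ^ t) {n : ℕ}
    (hn0 : 0 < |t - n|) (hn : |t - n| < 1 / 2) (k : ℤ) : w ≠ q ^ k := by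
  have hQ0 : 0 < ‖q‖ := norm_pos_iff.mpr hq0
  rintro rfl
  rw [norm_zpow, ← Real.rpow_intCast, Real.rpow_right_inj hQ0 hq1.ne] at hw
  exact ne_natCast_of_abs_sub hn0 hn k hw

lemma norm_eval_eq_prod [IsAlgClosed L] [IsUltrametricDist L] (P : Polynomial L) {z : L}
    (hz : ‖z‖ ∉ P.roots.map norm) :
    ‖P.eval z‖ = ‖P.leadingCoeff‖ * ((P.roots.map norm).map (max ‖z‖)).prod := by
  rw [(IsAlgClosed.splits P).eval_eq_prod_roots, norm_mul, Multiset.map_map]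
  congr 1
  have h : ‖(P.roots.map (z - ·)).prod‖ = ((P.roots.map (z - ·)).map norm).prod :=
    map_multiset_prod (normHom : L →*₀ ℝ) _
  rw [h, Multiset.map_map]
  refine congrArg _ (Multiset.map_congr rfl fun a ha => ?_)
  exact norm_sub_eq_max_norm fun h => hz (h ▸ Multiset.mem_map_of_mem _ ha)

open Filter Topology in
/-- The multiplicity of `r` in a finite multiset `M` of reals is the change of slope at `r` of the
associated tropical product. -/
lemma exists_eventually_prod_max (M : Multiset ℝ) {r : ℝ} (hr : 0 < r) :
    ∃ c : ℝ, 0 < c ∧ ∀ᶠ s in 𝓝[>] (1 : ℝ), r * s ∉ M ∧ r / s ∉ M ∧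
      (M.map (max (r * s))).prod * (M.map (max (r / s))).prod = c * s ^ M.count r := by
  have hev1 : ∀ᶠ s in 𝓝[>] (1 : ℝ), 1 < s := self_mem_nhdsWithin
  have hmul : Tendsto (fun s : ℝ => r * s) (𝓝[>] 1) (𝓝 r) := by
    have : Tendsto (fun s : ℝ => r * s) (𝓝 1) (𝓝 (r * 1)) :=
      (continuous_const.mul continuous_id).tendsto 1
    rw [mul_one] at this
    exact this.mono_left nhdsWithin_le_nhds
  have hdiv : Tendsto (fun s : ℝ => r / s) (𝓝[>] 1) (𝓝 r) := by
    have : Tendsto (fun s : ℝ => r / s) (𝓝 1) (𝓝 (r / 1)) :=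
      tendsto_const_nhds.div tendsto_id one_ne_zero
    rw [div_one] at this
    exact this.mono_left nhdsWithin_le_nhds
  induction M using Multiset.induction_on with
  | empty => exact ⟨1, one_pos, by simp⟩
  | cons a M ih =>
    obtain ⟨c, hc, h⟩ := ih
    rcases lt_trichotomy a r with har | rfl | har
    · refine ⟨r ^ 2 * c, by positivity, ?_⟩
      filter_upwards [h, hev1, hmul.eventually_const_lt har, hdiv.eventually_const_lt har]
        with s ⟨h1, h2, h3⟩ hs h4 h5
      refine ⟨by simp [h1, h4.ne'], by simp [h2, h5.ne'], ?_⟩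
      rw [Multiset.count_cons_of_ne har.ne']
      simp only [Multiset.map_cons, Multiset.prod_cons, max_eq_left h4.le, max_eq_left h5.le]
      rw [mul_mul_mul_comm, h3]
      field_simp
    · refine ⟨a ^ 2 * c, by positivity, ?_⟩
      filter_upwards [h, hev1] with s ⟨h1, h2, h3⟩ hs
      have h4 : a < a * s := lt_mul_of_one_lt_right hr hs
      have h5 : a / s < a := div_lt_self hr hs
      refine ⟨by simp [h1, h4.ne'], by simp [h2, h5.ne], ?_⟩
      rw [Multiset.count_cons_self]
      simp only [Multiset.map_cons, Multiset.prod_cons, max_eq_left h4.le, max_eq_right h5.le]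
      rw [mul_mul_mul_comm, h3]
      ring
    · have ha : 0 < a := hr.trans har
      refine ⟨a ^ 2 * c, by positivity, ?_⟩
      filter_upwards [h, hev1, hmul.eventually_lt_const har, hdiv.eventually_lt_const har]
        with s ⟨h1, h2, h3⟩ hs h4 h5
      refine ⟨by simp [h1, h4.ne], by simp [h2, h5.ne], ?_⟩
      rw [Multiset.count_cons_of_ne har.ne]
      simp only [Multiset.map_cons, Multiset.prod_cons, max_eq_right h4.le, max_eq_right h5.le]
      rw [mul_mul_mul_comm, h3]
      ring

/-- `FoldedAbs q m f g` says that `f / g` transforms absolute values as a Lattès map for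
multiplication by `m` does: on suitable points of valuation `t`, its value has as valuation the
distance from `m * t` to the nearest integer. -/
def FoldedAbs (q : L) (m : ℕ) (f g : Polynomial L) : Prop :=
  ∀ t : ℚ, 0 < t → t < 1 / 2 → ∀ n : ℕ, 0 < |(m : ℝ) * t - n| → |(m : ℝ) * t - n| < 1 / 2 →
    ∃ z y : L, ‖z‖ = ‖q‖ ^ (t : ℝ) ∧ ‖y‖ = ‖q‖ ^ |(m : ℝ) * t - n| ∧
      g.eval z ≠ 0 ∧ f.eval z = y * g.eval z

open Filter Topology in
lemma le_count_norm_roots [IsAlgClosed L] [IsUltrametricDist L] {q : L} (hq0 : q ≠ 0)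
    (hq1 : ‖q‖ < 1) {m : ℕ} {f g : Polynomial L} (H : FoldedAbs q m f g) {σ : ℝ}
    (hσ0 : 0 < σ) (hσ1 : σ < 1 / 2) {U : L} (hU : ‖U‖ = ‖q‖ ^ σ) {t₀ : ℚ} (ht0 : 0 < t₀)
    (ht1 : t₀ < 1 / 2) {n : ℕ} (hn : |(m : ℝ) * t₀ - n| = σ) :
    m ≤ ((f - Polynomial.C U * g).roots.map norm).count (‖q‖ ^ (t₀ : ℝ)) := by
  classical
  set A := f - Polynomial.C U * g with hA
  set Q := ‖q‖ with hQ
  have hQ0 : 0 < Q := norm_pos_iff.mpr hq0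
  have hr : 0 < Q ^ (t₀ : ℝ) := Real.rpow_pos_of_pos hQ0 _
  obtain ⟨cA, hcA, evA⟩ := exists_eventually_prod_max (A.roots.map norm) hr
  obtain ⟨cg, hcg, evg⟩ := exists_eventually_prod_max (g.roots.map norm) hr
  have ht0' : (0 : ℝ) < t₀ := by exact_mod_cast ht0
  have ht1' : (t₀ : ℝ) < 1 / 2 := by
    have : (t₀ : ℝ) < ((1 / 2 : ℚ) : ℝ) := by exact_mod_cast ht1
    simpa using this
  have hm : 0 < m := by
    rcases Nat.eq_zero_or_pos m with rfl | h
    · exfalso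
      rw [Nat.cast_zero, zero_mul, zero_sub, abs_neg, Nat.abs_cast] at hn
      have h1 : (n : ℝ) < 1 := by linarith
      have h2 : n = 0 := by have : n < 1 := by exact_mod_cast h1
                            omega
      rw [h2] at hn
      simp at hn
      linarith
    · exact h
  have hm' : (0 : ℝ) < m := by exact_mod_cast hm
  have key : ∀ δ : ℚ, 0 < δ → (δ : ℝ) < t₀ → (δ : ℝ) < 1 / 2 - t₀ → m * (δ : ℝ) < σ →
      m * (δ : ℝ) < 1 / 2 - σ → ∀ s : ℝ, s = Q ^ (-δ : ℝ) →
      (Q ^ (t₀ : ℝ) * s ∉ A.roots.map norm ∧ Q ^ (t₀ : ℝ) / s ∉ A.roots.map norm ∧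
        ((A.roots.map norm).map (max (Q ^ (t₀ : ℝ) * s))).prod *
        ((A.roots.map norm).map (max (Q ^ (t₀ : ℝ) / s))).prod =
        cA * s ^ (A.roots.map norm).count (Q ^ (t₀ : ℝ))) →
      (Q ^ (t₀ : ℝ) * s ∉ g.roots.map norm ∧ Q ^ (t₀ : ℝ) / s ∉ g.roots.map norm ∧
        ((g.roots.map norm).map (max (Q ^ (t₀ : ℝ) * s))).prod *
        ((g.roots.map norm).map (max (Q ^ (t₀ : ℝ) / s))).prod =
        cg * s ^ (g.roots.map norm).count (Q ^ (t₀ : ℝ))) →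
      g ≠ 0 ∧ ‖A.leadingCoeff‖ ^ 2 * cA * s ^ (A.roots.map norm).count (Q ^ (t₀ : ℝ)) =
        (‖g.leadingCoeff‖ ^ 2 * cg * (Q ^ σ) ^ 2) *
          s ^ (m + (g.roots.map norm).count (Q ^ (t₀ : ℝ))) := by
    intro δ hδ h1 h2 h3 h4 s hs ⟨a1, a2, a3⟩ ⟨b1, b2, b3⟩
    have hδ' : (0 : ℝ) < δ := by exact_mod_cast hδ
    have hmδ : 0 < m * (δ : ℝ) := by positivity
    have hsm : Q ^ (t₀ : ℝ) * s = Q ^ ((t₀ - δ : ℚ) : ℝ) := by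
      rw [hs, ← Real.rpow_add hQ0]; push_cast; ring_nf
    have hsd : Q ^ (t₀ : ℝ) / s = Q ^ ((t₀ + δ : ℚ) : ℝ) := by
      rw [hs, ← Real.rpow_sub hQ0]; push_cast; ring_nf
    have habs : (|(m : ℝ) * (t₀ - δ : ℚ) - n| = σ - m * δ ∧
        |(m : ℝ) * (t₀ + δ : ℚ) - n| = σ + m * δ) ∨
        (|(m : ℝ) * (t₀ - δ : ℚ) - n| = σ + m * δ ∧
        |(m : ℝ) * (t₀ + δ : ℚ) - n| = σ - m * δ) := by
      push_cast
      rcases abs_eq hσ0.le |>.mp hn with h | h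
      · left
        constructor
        · rw [abs_of_pos (by linarith)]; linarith
        · rw [abs_of_pos (by linarith)]; linarith
      · right
        constructor
        · rw [abs_of_neg (by linarith)]; linarith
        · rw [abs_of_neg (by linarith)]; linarith
    obtain ⟨z₁, y₁, hz₁, hy₁, hg₁, hf₁⟩ := H (t₀ - δ) (by have : δ < t₀ := by exact_mod_cast h1
                                                          linarith)
      (by linarith) n (by rcases habs with h | h <;> rw [h.1] <;> linarith)
      (by rcases habs with h | h <;> rw [h.1] <;> linarith)
    obtain ⟨z₂, y₂, hz₂, hy₂, hg₂, hf₂⟩ := H (t₀ + δ) (by linarith)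
      (by have : ((t₀ + δ : ℚ) : ℝ) < ((1 / 2 : ℚ) : ℝ) := by push_cast; linarith
          exact_mod_cast this) n (by rcases habs with h | h <;> rw [h.2] <;> linarith)
      (by rcases habs with h | h <;> rw [h.2] <;> linarith)
    have hAe : ∀ z y : L, ‖y‖ ≠ ‖U‖ → f.eval z = y * g.eval z →
        ‖A.eval z‖ = max ‖y‖ ‖U‖ * ‖g.eval z‖ := by
      intro z y hy hf
      rw [hA, Polynomial.eval_sub, Polynomial.eval_mul, Polynomial.eval_C, hf, ← sub_mul, norm_mul,
        norm_sub_eq_max_norm hy]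
    have hlt : Q ^ σ < Q ^ (σ - m * δ) :=
      Real.rpow_lt_rpow_of_exponent_gt hQ0 hq1 (by linarith)
    have hgt : Q ^ (σ + m * δ) < Q ^ σ :=
      Real.rpow_lt_rpow_of_exponent_gt hQ0 hq1 (by linarith)
    have hprod : ‖A.eval z₁‖ * ‖A.eval z₂‖ =
        (Q ^ (σ - m * δ) * Q ^ σ) * (‖g.eval z₁‖ * ‖g.eval z₂‖) := by
      rw [← hQ] at hy₁ hy₂
      rcases habs with ⟨h, h'⟩ | ⟨h, h'⟩
      · rw [h] at hy₁; rw [h'] at hy₂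
        rw [hAe z₁ y₁ (by rw [hy₁, hU]; exact hlt.ne') hf₁,
          hAe z₂ y₂ (by rw [hy₂, hU]; exact hgt.ne) hf₂, hy₁, hy₂, hU, max_eq_left hlt.le,
          max_eq_right hgt.le]
        ring
      · rw [h] at hy₁; rw [h'] at hy₂
        rw [hAe z₁ y₁ (by rw [hy₁, hU]; exact hgt.ne) hf₁,
          hAe z₂ y₂ (by rw [hy₂, hU]; exact hlt.ne') hf₂, hy₁, hy₂, hU, max_eq_left hlt.le,
          max_eq_right hgt.le]
        ring
    have hspow : Q ^ (σ - m * δ) = Q ^ σ * s ^ m := by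
      rw [hs, ← Real.rpow_natCast, ← Real.rpow_mul hQ0.le, ← Real.rpow_add hQ0]
      ring_nf
    rw [hsm] at a1 a3 b1 b3
    rw [hsd] at a2 a3 b2 b3
    rw [← hQ] at hz₁ hz₂
    rw [← hz₁] at a1 a3 b1 b3
    rw [← hz₂] at a2 a3 b2 b3
    rw [norm_eval_eq_prod A a1, norm_eval_eq_prod A a2, norm_eval_eq_prod g b1,
      norm_eval_eq_prod g b2, mul_mul_mul_comm, a3, mul_mul_mul_comm ‖g.leadingCoeff‖, b3,
      hspow] at hprod
    refine ⟨fun h => hg₁ (by rw [h, Polynomial.eval_zero]), ?_⟩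
    rw [pow_add]
    linear_combination hprod
  have ev := evA.and evg
  have htend : ∀ c : ℝ, 0 < c → Tendsto (fun δ : ℝ => Q ^ (-(c * δ))) (𝓝[>] 0) (𝓝[>] 1) := by
    intro c hc
    refine tendsto_nhdsWithin_iff.mpr ⟨?_, ?_⟩
    · have : Continuous fun δ : ℝ => Q ^ (-(c * δ)) :=
        Real.continuous_const_rpow hQ0.ne' |>.comp (by fun_prop)
      have h := this.tendsto 0
      simp only [mul_zero, neg_zero, Real.rpow_zero] at h
      exact h.mono_left nhdsWithin_le_nhds
    · filter_upwards [self_mem_nhdsWithin] with δ hδ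
      have hδ : 0 < δ := hδ
      exact Real.one_lt_rpow_of_pos_of_lt_one_of_neg hQ0 hq1 (neg_neg_of_pos (by positivity))
  have hsmall : ∀ c : ℝ, 0 < c → ∀ᶠ δ in 𝓝[>] (0 : ℝ), δ < c := fun c hc =>
    (eventually_lt_nhds hc).filter_mono nhdsWithin_le_nhds
  have hall := ((htend 1 one_pos).eventually ev).and (((htend 2 two_pos).eventually ev).and
    ((hsmall (t₀ / 2) (by positivity)).and ((hsmall ((1 / 2 - t₀) / 2) (by linarith)).and
      ((hsmall (σ / (2 * m)) (by positivity)).and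
        (hsmall ((1 / 2 - σ) / (2 * m)) (div_pos (by linarith) (by positivity)))))))
  obtain ⟨ε, hε, hsub⟩ := mem_nhdsGT_iff_exists_Ioo_subset.mp hall
  obtain ⟨δ, hδ0, hδε⟩ := exists_rat_btwn (show (0 : ℝ) < ε from hε)
  obtain ⟨⟨e1, e2⟩, ⟨e3, e4⟩, l1, l2, l3, l4⟩ := hsub ⟨hδ0, hδε⟩
  rw [lt_div_iff₀ (by positivity)] at l3 l4
  have hδ : 0 < δ := by exact_mod_cast hδ0
  obtain ⟨hg, k1⟩ := key δ hδ (by linarith) (by linarith) (by linarith) (by linarith) _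
    (by rw [one_mul]) e1 e2
  obtain ⟨-, k2⟩ := key (2 * δ) (by linarith) (by push_cast; linarith) (by push_cast; linarith)
    (by push_cast; linarith) (by push_cast; linarith) _ (by push_cast; rfl) e3 e4
  set N := (A.roots.map norm).count (Q ^ (t₀ : ℝ))
  set N' := m + (g.roots.map norm).count (Q ^ (t₀ : ℝ)) with hN'
  set s := Q ^ (-(1 * δ : ℝ)) with hs
  have hs2 : Q ^ (-(2 * δ : ℝ)) = s ^ 2 := by
    rw [hs, ← Real.rpow_natCast, ← Real.rpow_mul hQ0.le]; push_cast; ring_nf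
  have hs1 : 1 < s := Real.one_lt_rpow_of_pos_of_lt_one_of_neg hQ0 hq1 (by linarith)
  rw [hs2, ← pow_mul, ← pow_mul, mul_comm 2 N, mul_comm 2 N', pow_mul, pow_mul] at k2
  have hb : 0 < ‖g.leadingCoeff‖ ^ 2 * cg * (Q ^ σ) ^ 2 := by
    have : 0 < ‖g.leadingCoeff‖ := norm_pos_iff.mpr (Polynomial.leadingCoeff_ne_zero.mpr hg)
    positivity
  have hsN : 0 < s ^ N' := by positivity
  have hNN : s ^ N = s ^ N' := by
    have : (‖g.leadingCoeff‖ ^ 2 * cg * (Q ^ σ) ^ 2) * s ^ N' * (s ^ N - s ^ N') = 0 := by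
      linear_combination k2 - s ^ N * k1
    rcases mul_eq_zero.mp this with h | h
    · exact absurd h (by positivity)
    · linarith
  have : N = N' := (pow_right_injective₀ (by linarith) hs1.ne') hNN
  omega

/-- The solution `x ∈ (j, j + 1)` of the congruence `x / 2 ≡ ± σ` modulo `1`. -/
def foldPoint (σ : ℚ) (j : ℕ) : ℚ := if Even j then j + 2 * σ else j + 1 - 2 * σ

lemma lt_foldPoint {σ : ℚ} (h0 : 0 < σ) (h1 : σ < 1 / 2) (j : ℕ) : (j : ℚ) < foldPoint σ j := by
  unfold foldPoint; split_ifs <;> linarith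

lemma foldPoint_lt {σ : ℚ} (h0 : 0 < σ) (h1 : σ < 1 / 2) (j : ℕ) : foldPoint σ j < j + 1 := by
  unfold foldPoint; split_ifs <;> linarith

lemma two_mul_le_foldPoint {σ : ℚ} (h1 : σ < 1 / 2) (j : ℕ) : 2 * σ ≤ foldPoint σ j := by
  have := (Nat.cast_nonneg j : (0 : ℚ) ≤ j)
  unfold foldPoint; split_ifs with h
  · linarith
  · have : (1 : ℚ) ≤ j := by exact_mod_cast (Nat.not_even_iff_odd.mp h).pos
    linarith

lemma abs_foldPoint_sub {σ : ℚ} (h0 : 0 < σ) (j : ℕ) :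
    |foldPoint σ j / 2 - ((j + 1) / 2 : ℕ)| = σ := by
  rcases Nat.even_or_odd' j with ⟨k, rfl | rfl⟩
  · rw [foldPoint, if_pos (even_two_mul k), show (2 * k + 1) / 2 = k by omega]
    push_cast
    rw [show (2 * (k : ℚ) + 2 * σ) / 2 - k = σ by ring, abs_of_pos h0]
  · rw [foldPoint, if_neg (by simp), show (2 * k + 1 + 1) / 2 = k + 1 by omega]
    push_cast
    rw [show (2 * (k : ℚ) + 1 + 1 - 2 * σ) / 2 - (k + 1) = -σ by ring, abs_neg, abs_of_pos h0]

lemma foldPoint_lt_foldPoint {σ ρ : ℚ} (hσ0 : 0 < σ) (hσ1 : σ < 1 / 2) (hρ0 : 0 < ρ)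
    (hρ1 : ρ < 1 / 2) {i j : ℕ} (h : i < j) : foldPoint σ i < foldPoint ρ j := by
  have h1 : (i : ℚ) + 1 ≤ j := by exact_mod_cast h
  have := foldPoint_lt hσ0 hσ1 i
  have := lt_foldPoint hρ0 hρ1 j
  linarith

lemma foldPoint_ne {σ ρ : ℚ} (hσ0 : 0 < σ) (hσ1 : σ < 1 / 2) (hρ0 : 0 < ρ)
    (hρ1 : ρ < 1 / 2) (hσρ : σ < ρ) (i j : ℕ) : foldPoint σ i ≠ foldPoint ρ j := by
  rcases lt_trichotomy i j with h | rfl | h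
  · exact (foldPoint_lt_foldPoint hσ0 hσ1 hρ0 hρ1 h).ne
  · unfold foldPoint
    split_ifs
    · intro h; linarith
    · intro h; linarith
  · exact (foldPoint_lt_foldPoint hρ0 hρ1 hσ0 hσ1 h).ne'

lemma sum_foldPoint (σ : ℚ) (N : ℕ) : ∑ j ∈ Finset.range N, foldPoint σ j =
    if Even N then (N : ℚ) ^ 2 / 2 else ((N : ℚ) ^ 2 - 1) / 2 + 2 * σ := by
  induction N with
  | zero => simp
  | succ N ih =>
    rw [Finset.sum_range_succ, ih]
    by_cases h : Even N
    · simp only [h, foldPoint, if_true, Nat.even_add_one, not_true, if_false]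
      push_cast; ring
    · simp only [h, foldPoint, if_true, Nat.even_add_one, not_false_eq_true, if_false]
      push_cast; ring

lemma sum_min_foldPoint {σ ρ : ℚ} (hσ0 : 0 < σ) (hσ1 : σ < 1 / 2) (hρ0 : 0 < ρ)
    (hρ1 : ρ < 1 / 2) (hσρ : σ < ρ) (N : ℕ) :
    ∑ i ∈ Finset.range N, ∑ j ∈ Finset.range N, min (foldPoint σ i) (foldPoint ρ j) =
      2 * N * σ + N * (N ^ 2 - 1) / 3 := by
  induction N with
  | zero => simp
  | succ N ih =>
    have h1 : ∑ i ∈ Finset.range N, min (foldPoint σ i) (foldPoint ρ N) =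
        ∑ i ∈ Finset.range N, foldPoint σ i := Finset.sum_congr rfl fun i hi =>
      min_eq_left (foldPoint_lt_foldPoint hσ0 hσ1 hρ0 hρ1 (Finset.mem_range.mp hi)).le
    have h2 : ∑ j ∈ Finset.range N, min (foldPoint σ N) (foldPoint ρ j) =
        ∑ j ∈ Finset.range N, foldPoint ρ j := Finset.sum_congr rfl fun j hj =>
      min_eq_right (foldPoint_lt_foldPoint hρ0 hρ1 hσ0 hσ1 (Finset.mem_range.mp hj)).le
    simp only [Finset.sum_range_succ, Finset.sum_add_distrib]
    rw [ih, h1, h2, sum_foldPoint, sum_foldPoint]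
    by_cases h : Even N
    · simp only [h, foldPoint, if_true]
      rw [min_eq_left (by linarith)]
      push_cast; ring
    · simp only [h, foldPoint, if_false]
      rw [min_eq_right (by linarith)]
      push_cast; ring

/-- The absolute values, with multiplicity, of the solutions of `ψ z = U` with `‖U‖ = ‖q‖ ^ σ` for a
Lattès map `ψ` for multiplication by `m`. -/
def fibreNorms (q : L) (m : ℕ) (σ : ℚ) : Multiset ℝ :=
  ∑ j ∈ Finset.range m, Multiset.replicate m (‖q‖ ^ ((foldPoint σ j / (2 * m) : ℚ) : ℝ))

lemma mem_fibreNorms {q : L} {m : ℕ} {σ : ℚ} {r : ℝ} (h : r ∈ fibreNorms q m σ) :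
    ∃ j < m, r = ‖q‖ ^ ((foldPoint σ j / (2 * m) : ℚ) : ℝ) := by
  obtain ⟨j, hj, hr⟩ := Multiset.mem_sum.mp h
  exact ⟨j, Finset.mem_range.mp hj, Multiset.eq_of_mem_replicate hr⟩

lemma card_fibreNorms (q : L) (m : ℕ) (σ : ℚ) : (fibreNorms q m σ).card = m ^ 2 := by
  simp [fibreNorms, Multiset.card_sum, sq]

lemma prod_map_fibreNorms (q : L) (m : ℕ) (σ : ℚ) (φ : ℝ → ℝ) :
    ((fibreNorms q m σ).map φ).prod =
      ∏ j ∈ Finset.range m, φ (‖q‖ ^ ((foldPoint σ j / (2 * m) : ℚ) : ℝ)) ^ m := by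
  have : (fibreNorms q m σ).map φ = ∑ j ∈ Finset.range m,
      (Multiset.replicate m (‖q‖ ^ ((foldPoint σ j / (2 * m) : ℚ) : ℝ))).map φ :=
    map_sum (Multiset.mapAddMonoidHom φ) _ _
  rw [this, Multiset.prod_sum]
  simp

lemma natDegree_sub_C_mul_le {d : ℕ} {f g : Polynomial L} (hf : f.natDegree ≤ d)
    (hg : g.natDegree ≤ d) (U : L) : (f - Polynomial.C U * g).natDegree ≤ d :=
  (Polynomial.natDegree_sub_le_of_le hf ((Polynomial.natDegree_C_mul_le _ _).trans hg)).trans_eq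
    (max_self d)

lemma norm_roots_eq_fibreNorms [IsAlgClosed L] [IsUltrametricDist L] {q : L} (hq0 : q ≠ 0)
    (hq1 : ‖q‖ < 1) {m : ℕ} {f g : Polynomial L} (H : FoldedAbs q m f g)
    (hf : f.natDegree ≤ m ^ 2) (hg : g.natDegree ≤ m ^ 2) {σ : ℚ}
    (hσ0 : 0 < σ) (hσ1 : σ < 1 / 2) {U : L} (hU : ‖U‖ = ‖q‖ ^ (σ : ℝ)) :
    (f - Polynomial.C U * g).roots.map norm = fibreNorms q m σ ∧
      (f - Polynomial.C U * g).natDegree = m ^ 2 := by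
  classical
  set A := f - Polynomial.C U * g with hA
  have hQ0 : 0 < ‖q‖ := norm_pos_iff.mpr hq0
  have hσ1' : (σ : ℝ) < 1 / 2 := by
    have : (σ : ℝ) < ((1 / 2 : ℚ) : ℝ) := by exact_mod_cast hσ1
    simpa using this
  have hdeg : A.natDegree ≤ m ^ 2 := natDegree_sub_C_mul_le hf hg U
  have hle : fibreNorms q m σ ≤ A.roots.map norm := by
    rw [Multiset.le_iff_count]
    intro r
    by_cases hr : r ∈ fibreNorms q m σ
    · obtain ⟨j, hj, rfl⟩ := mem_fibreNorms hr
      have hm : 0 < m := by omega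
      have hm' : (0 : ℚ) < m := by exact_mod_cast hm
      have hcount : (fibreNorms q m σ).count (‖q‖ ^ ((foldPoint σ j / (2 * m) : ℚ) : ℝ)) = m := by
        rw [fibreNorms, Multiset.count_sum', Finset.sum_eq_single j]
        · simp
        · intro i _ hij
          rw [Multiset.count_replicate, if_neg]
          intro h
          rw [Real.rpow_right_inj hQ0 hq1.ne, Rat.cast_inj,
            div_left_inj' (by positivity)] at h
          rcases lt_or_gt_of_ne hij with h' | h'
          · exact (foldPoint_lt_foldPoint hσ0 hσ1 hσ0 hσ1 h').ne h
          · exact (foldPoint_lt_foldPoint hσ0 hσ1 hσ0 hσ1 h').ne' h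
        · intro h; exact absurd (Finset.mem_range.mpr hj) h
      rw [hcount]
      have hx0 := lt_foldPoint hσ0 hσ1 j
      have hx1 := foldPoint_lt hσ0 hσ1 j
      have hj0 : (0 : ℚ) ≤ j := Nat.cast_nonneg j
      have hjm : (j : ℚ) + 1 ≤ m := by exact_mod_cast hj
      refine le_count_norm_roots hq0 hq1 H (by exact_mod_cast hσ0) hσ1' hU
        (div_pos (by linarith) (by positivity)) ?_ (n := (j + 1) / 2) ?_
      · rw [div_lt_iff₀ (by positivity)]; linarith
      · have h := abs_foldPoint_sub hσ0 j
        have h' : (m : ℚ) * (foldPoint σ j / (2 * m)) = foldPoint σ j / 2 := by field_simp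
        rw [← h'] at h
        exact_mod_cast congrArg (Rat.cast : ℚ → ℝ) h
    · rw [Multiset.count_eq_zero_of_notMem hr]; exact Nat.zero_le _
  have hcard := Multiset.card_le_card hle
  rw [card_fibreNorms, Multiset.card_map] at hcard
  have hroots := Polynomial.card_roots' A
  refine ⟨(Multiset.eq_of_le_of_card_le hle ?_).symm, by omega⟩
  rw [Multiset.card_map, card_fibreNorms]
  omega

lemma norm_resultant_eq_prod [IsAlgClosed L] [IsUltrametricDist L] {d : ℕ} {A B : Polynomial L}
    (hA : A.natDegree = d) (hB : B.natDegree = d)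
    (h : ∀ r ∈ A.roots.map norm, r ∉ B.roots.map norm) :
    ‖Polynomial.resultant A B d d‖ = ‖A.leadingCoeff‖ ^ d * ‖B.leadingCoeff‖ ^ d *
      ((A.roots.map norm).map fun r => ((B.roots.map norm).map (max r)).prod).prod := by
  have hres := Polynomial.resultant_eq_prod_eval A B d hB.le (IsAlgClosed.splits A)
  rw [hA] at hres
  have hn : ‖(A.roots.map B.eval).prod‖ = ((A.roots.map B.eval).map norm).prod :=
    map_multiset_prod (normHom : L →*₀ ℝ) _
  have hev : (A.roots.map B.eval).map norm = A.roots.map fun a =>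
      ‖B.leadingCoeff‖ * ((B.roots.map norm).map (max ‖a‖)).prod := by
    rw [Multiset.map_map]
    exact Multiset.map_congr rfl fun a ha =>
      norm_eval_eq_prod B (h _ (Multiset.mem_map_of_mem _ ha))
  rw [hres, norm_mul, norm_pow, hn, hev, Multiset.prod_map_mul, Multiset.map_const',
    Multiset.prod_replicate, ← (IsAlgClosed.splits A).natDegree_eq_card_roots, hA,
    Multiset.map_map, mul_assoc]
  rfl

lemma resultant_sub_C_mul {d : ℕ} {f g : Polynomial L} (hf : f.natDegree ≤ d)
    (hg : g.natDegree ≤ d) (U V : L) :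
    Polynomial.resultant (f - Polynomial.C U * g) (f - Polynomial.C V * g) d d =
      (U - V) ^ d * Polynomial.resultant f g d d := by
  have h1 : f - Polynomial.C V * g = Polynomial.C (U - V) * g + (f - Polynomial.C U * g) * 1 := by
    rw [Polynomial.C_sub]; ring
  have h2 : f - Polynomial.C U * g = f + g * Polynomial.C (-U) := by
    rw [Polynomial.C_neg]; ring
  rw [h1, Polynomial.resultant_add_mul_right _ _ _ _ _ (by simp) (natDegree_sub_C_mul_le hf hg U),
    Polynomial.resultant_C_mul_right, h2, Polynomial.resultant_add_mul_left _ _ _ _ _ (by simp) hg]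

lemma norm_coeff_prod_X_sub_C_le_one [IsUltrametricDist L] (s : Multiset L)
    (hs : ∀ a ∈ s, ‖a‖ ≤ 1) (k : ℕ) :
    ‖((s.map fun a => Polynomial.X - Polynomial.C a).prod).coeff k‖ ≤ 1 := by
  induction s using Multiset.induction_on generalizing k with
  | empty =>
    simp only [Multiset.map_zero, Multiset.prod_zero, Polynomial.coeff_one]
    split_ifs <;> simp
  | cons a s ih =>
    have ih' := ih fun b hb => hs b (Multiset.mem_cons_of_mem hb)
    have ha := hs a (Multiset.mem_cons_self a s)
    have hmul : ∀ k, ‖a * ((s.map fun a => Polynomial.X - Polynomial.C a).prod).coeff k‖ ≤ 1 :=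
      fun k => by rw [norm_mul]; exact mul_le_one₀ ha (norm_nonneg _) (ih' k)
    rw [Multiset.map_cons, Multiset.prod_cons, sub_mul, Polynomial.coeff_sub,
      Polynomial.coeff_C_mul]
    refine (norm_sub_le_max_norm_s12 _ _).trans (max_le ?_ (hmul k))
    rcases k with _ | k
    · simp
    · rw [Polynomial.coeff_X_mul]; exact ih' k

lemma norm_coeff_le_leadingCoeff [IsAlgClosed L] [IsUltrametricDist L] {A : Polynomial L}
    (hA : ∀ r ∈ A.roots.map norm, r ≤ 1) (k : ℕ) : ‖A.coeff k‖ ≤ ‖A.leadingCoeff‖ := by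
  conv_lhs => rw [(IsAlgClosed.splits A).eq_prod_roots]
  rw [Polynomial.coeff_C_mul, norm_mul]
  exact mul_le_of_le_one_right (norm_nonneg _) (norm_coeff_prod_X_sub_C_le_one _
    (fun a ha => hA _ (Multiset.mem_map_of_mem _ ha)) k)

lemma foldedAbs_of_semiconj [IsAlgClosed L] [CompleteSpace L] [IsUltrametricDist L] {q : L}
    (hq0 : q ≠ 0) (hq1 : ‖q‖ < 1) {m d : ℕ} (hm : 0 < m) {f g : Polynomial L}
    (hf : f.natDegree ≤ d) (hg : g.natDegree ≤ d)
    (hsemi : ∀ w : L, w ≠ 0 → (∀ n : ℤ, w ≠ q ^ n) → (∀ n : ℤ, w ^ m ≠ q ^ n) →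
      MvPolynomial.eval ![xTate L q w, 1] (g.homogenize d) ≠ 0 ∧
      MvPolynomial.eval ![xTate L q w, 1] (f.homogenize d) =
        xTate L q (w ^ m) * MvPolynomial.eval ![xTate L q w, 1] (g.homogenize d)) :
    FoldedAbs q m f g := by
  intro t ht0 ht1 n hn0 hn
  obtain ⟨w, hw0, hw⟩ := exists_norm_eq_rpow hq0 t
  have ht0' : (0 : ℝ) < t := by exact_mod_cast ht0
  have ht1' : (t : ℝ) < 1 / 2 := by
    have : (t : ℝ) < ((1 / 2 : ℚ) : ℝ) := by exact_mod_cast ht1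
    simpa using this
  have hm' : (0 : ℝ) < m := by exact_mod_cast hm
  have habs : |(t : ℝ) - (0 : ℕ)| = t := by rw [Nat.cast_zero, sub_zero, abs_of_pos ht0']
  have hwm : ‖w ^ m‖ = ‖q‖ ^ ((m : ℝ) * t) := by
    rw [norm_pow, hw, ← Real.rpow_natCast, ← Real.rpow_mul (norm_nonneg _), mul_comm]
  have hz := norm_xTate hq0 hq1 ht0' hw (n := 0) (by rwa [habs]) (by rwa [habs])
  rw [habs] at hz
  have heval : ∀ {p : Polynomial L}, p.natDegree ≤ d → ∀ z : L,
      MvPolynomial.eval ![z, 1] (p.homogenize d) = p.eval z := fun hp z => by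
    rw [Polynomial.eval_homogenize hp _ (by simp)]
    simp
  have h := hsemi w hw0 (norm_ne_zpow hq0 hq1 hw (n := 0) (by rwa [habs]) (by rwa [habs]))
    (norm_ne_zpow hq0 hq1 hwm hn0 hn)
  rw [heval hf, heval hg] at h
  exact ⟨_, _, hz, norm_xTate hq0 hq1 (by positivity) hwm hn0 hn, h⟩

lemma lt_rpow_of_mem_fibreNorms {q : L} (hq0 : q ≠ 0) (hq1 : ‖q‖ < 1) {m : ℕ} {σ : ℚ}
    (hσ1 : σ < 1 / 2) {r : ℝ} (hr : r ∈ fibreNorms q m σ) {t : ℚ}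
    (ht : m * t < σ) : r < ‖q‖ ^ (t : ℝ) := by
  obtain ⟨j, hj, rfl⟩ := mem_fibreNorms hr
  have hm : (0 : ℚ) < m := by exact_mod_cast (Nat.zero_le j).trans_lt hj
  refine Real.rpow_lt_rpow_of_exponent_gt (norm_pos_iff.mpr hq0) hq1 ?_
  have := two_mul_le_foldPoint hσ1 j
  have : t < foldPoint σ j / (2 * m) := by
    rw [lt_div_iff₀ (by positivity)]; linarith
  exact_mod_cast this

lemma norm_leadingCoeff_eq [IsAlgClosed L] [IsUltrametricDist L] {q : L} (hq0 : q ≠ 0)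
    (hq1 : ‖q‖ < 1) {m : ℕ} (hm : 0 < m) {f g : Polynomial L} (H : FoldedAbs q m f g)
    (hf : f.natDegree ≤ m ^ 2) (hg : g.natDegree ≤ m ^ 2) {σ ρ : ℚ}
    (hσ0 : 0 < σ) (hσ1 : σ < 1 / 2) (hρ0 : 0 < ρ) (hρ1 : ρ < 1 / 2) {U V : L}
    (hU : ‖U‖ = ‖q‖ ^ (σ : ℝ)) (hV : ‖V‖ = ‖q‖ ^ (ρ : ℝ)) :
    ‖(f - Polynomial.C U * g).leadingCoeff‖ = ‖(f - Polynomial.C V * g).leadingCoeff‖ := by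
  have hQ0 : 0 < ‖q‖ := norm_pos_iff.mpr hq0
  have hm' : (0 : ℚ) < m := by exact_mod_cast hm
  have hm1 : (1 : ℚ) ≤ m := by exact_mod_cast hm
  obtain ⟨μ, hμ0, hμσ, hμρ⟩ : ∃ μ : ℚ, 0 < μ ∧ μ < σ ∧ μ < ρ :=
    ⟨min σ ρ / 2, by positivity, by linarith [min_le_left σ ρ, lt_min hσ0 hρ0],
      by linarith [min_le_right σ ρ, lt_min hσ0 hρ0]⟩
  have hmt : (m : ℚ) * (μ / m) = μ := by field_simp
  have habs : |(m : ℝ) * (μ / m : ℚ) - (0 : ℕ)| = μ := by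
    have : (m : ℝ) * (μ / m : ℚ) = μ := by exact_mod_cast congrArg (Rat.cast : ℚ → ℝ) hmt
    rw [this, Nat.cast_zero, sub_zero, abs_of_pos (by exact_mod_cast hμ0)]
  obtain ⟨z, y, hz, hy, hgz, hfz⟩ := H (μ / m) (by positivity)
    ((div_le_self hμ0.le hm1).trans_lt (by linarith)) 0
    (by rw [habs]; exact_mod_cast hμ0)
    (by rw [habs]
        have : (μ : ℝ) < ((1 / 2 : ℚ) : ℝ) := by exact_mod_cast hμσ.trans hσ1
        simpa using this)
  rw [habs] at hy
  have key : ∀ {τ : ℚ} {W : L}, 0 < τ → τ < 1 / 2 → μ < τ → ‖W‖ = ‖q‖ ^ (τ : ℝ) →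
      ‖(f - Polynomial.C W * g).leadingCoeff‖ * ‖z‖ ^ m ^ 2 = ‖y‖ * ‖g.eval z‖ := by
    intro τ W hτ0 hτ1 hμτ hW
    have hroots := (norm_roots_eq_fibreNorms hq0 hq1 H hf hg hτ0 hτ1 hW).1
    have hlt : ∀ r ∈ (f - Polynomial.C W * g).roots.map norm, r < ‖z‖ := fun r hr => by
      rw [hroots] at hr
      exact hz ▸ lt_rpow_of_mem_fibreNorms hq0 hq1 hτ1 hr (hmt.symm ▸ hμτ)
    have hWy : ‖W‖ < ‖y‖ := by
      rw [hW, hy]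
      exact Real.rpow_lt_rpow_of_exponent_gt hQ0 hq1 (by exact_mod_cast hμτ)
    have h1 : ‖(f - Polynomial.C W * g).eval z‖ = ‖y‖ * ‖g.eval z‖ := by
      rw [Polynomial.eval_sub, Polynomial.eval_mul, Polynomial.eval_C, hfz, ← sub_mul, norm_mul,
        norm_sub_eq_max_norm hWy.ne', max_eq_left hWy.le]
    rw [← h1, norm_eval_eq_prod _ fun h => (hlt _ h).false,
      Multiset.map_congr rfl fun r hr => max_eq_left (hlt r hr).le, Multiset.map_const',
      Multiset.prod_replicate, hroots, card_fibreNorms]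
  have hz0 : 0 < ‖z‖ := hz ▸ Real.rpow_pos_of_pos hQ0 _
  exact mul_right_cancel₀ (pow_pos hz0 (m ^ 2)).ne'
    ((key hσ0 hσ1 hμσ hU).trans (key hρ0 hρ1 hμρ hV).symm)

open Filter Topology in
lemma exists_rat_lt_rpow {Q κ : ℝ} (hQ : Q ≠ 0) (hκ : κ < 1) {ρ : ℚ} (hρ : 0 < ρ) :
    ∃ σ : ℚ, 0 < σ ∧ σ < ρ ∧ κ < Q ^ (σ : ℝ) := by
  have h : Tendsto (fun x : ℝ => Q ^ x) (𝓝[>] 0) (𝓝 1) := by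
    have := (Real.continuous_const_rpow hQ).tendsto 0
    rw [Real.rpow_zero] at this
    exact this.mono_left nhdsWithin_le_nhds
  have hρ' : (0 : ℝ) < ρ := by exact_mod_cast hρ
  obtain ⟨ε, hε, hsub⟩ := mem_nhdsGT_iff_exists_Ioo_subset.mp
    ((h.eventually_const_lt hκ).and
      ((eventually_lt_nhds hρ').filter_mono nhdsWithin_le_nhds))
  obtain ⟨σ, hσ0, hσε⟩ := exists_rat_btwn (show (0 : ℝ) < ε from hε)
  obtain ⟨h1, h2⟩ := hsub ⟨hσ0, hσε⟩
  exact ⟨σ, by exact_mod_cast hσ0, by exact_mod_cast h2, h1⟩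

lemma norm_leadingCoeff_eq_one [IsAlgClosed L] [IsUltrametricDist L] {q : L} (hq0 : q ≠ 0)
    (hq1 : ‖q‖ < 1) {m : ℕ} (hm : 0 < m) {f g : Polynomial L} (H : FoldedAbs q m f g)
    (hf : f.natDegree ≤ m ^ 2) (hg : g.natDegree ≤ m ^ 2)
    (hf1 : ∀ k, ‖f.coeff k‖ ≤ 1) (hg1 : ∀ k, ‖g.coeff k‖ ≤ 1)
    (hfg : ∃ k, ‖f.coeff k‖ = 1 ∨ ‖g.coeff k‖ = 1) {ρ : ℚ} (hρ0 : 0 < ρ) (hρ1 : ρ < 1 / 2) {V : L}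
    (hV : ‖V‖ = ‖q‖ ^ (ρ : ℝ)) : ‖(f - Polynomial.C V * g).leadingCoeff‖ = 1 := by
  have hQ0 : 0 < ‖q‖ := norm_pos_iff.mpr hq0
  have hlt1 : ∀ {τ : ℚ}, 0 < τ → ‖q‖ ^ (τ : ℝ) < 1 := fun h =>
    Real.rpow_lt_one hQ0.le hq1 (by exact_mod_cast h)
  refine le_antisymm ?_ (le_of_not_gt fun hκ => ?_)
  · rw [Polynomial.leadingCoeff, Polynomial.coeff_sub, Polynomial.coeff_C_mul]
    refine (norm_sub_le_max_norm_s12 _ _).trans (max_le (hf1 _) ?_)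
    rw [norm_mul]
    exact mul_le_one₀ (hV ▸ (hlt1 hρ0).le) (norm_nonneg _) (hg1 _)
  · obtain ⟨σ, hσ0, hσρ, hσκ⟩ := exists_rat_lt_rpow hQ0.ne' hκ hρ0
    obtain ⟨U, -, hU⟩ := exists_norm_eq_rpow hq0 σ
    have hcoeff : ∀ {τ : ℚ} {W : L}, 0 < τ → τ < 1 / 2 → ‖W‖ = ‖q‖ ^ (τ : ℝ) → ∀ k,
        ‖f.coeff k - W * g.coeff k‖ ≤ ‖(f - Polynomial.C V * g).leadingCoeff‖ := by
      intro τ W hτ0 hτ1 hW k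
      rw [← norm_leadingCoeff_eq hq0 hq1 hm H hf hg hτ0 hτ1 hρ0 hρ1 hW hV,
        ← Polynomial.coeff_C_mul, ← Polynomial.coeff_sub]
      refine norm_coeff_le_leadingCoeff (fun r hr => ?_) k
      rw [(norm_roots_eq_fibreNorms hq0 hq1 H hf hg hτ0 hτ1 hW).1] at hr
      simpa using
        (lt_rpow_of_mem_fibreNorms hq0 hq1 hτ1 hr (t := 0) (by rwa [mul_zero])).le
    have hVU : ‖V‖ < ‖U‖ := by
      rw [hU, hV]
      exact Real.rpow_lt_rpow_of_exponent_gt hQ0 hq1 (by exact_mod_cast hσρ)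
    have hglt : ∀ k, ‖g.coeff k‖ < 1 := fun k => by
      have h1 : (V - U) * g.coeff k =
          (f.coeff k - U * g.coeff k) - (f.coeff k - V * g.coeff k) := by ring
      have h2 : ‖U‖ * ‖g.coeff k‖ ≤ ‖(f - Polynomial.C V * g).leadingCoeff‖ := by
        rw [← max_eq_right hVU.le, ← norm_sub_eq_max_norm hVU.ne, ← norm_mul, h1]
        exact (norm_sub_le_max_norm_s12 _ _).trans
          (max_le (hcoeff hσ0 (hσρ.trans hρ1) hU k) (hcoeff hρ0 hρ1 hV k))
      rw [← hU] at hσκ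
      by_contra! hge
      exact (h2.trans_lt hσκ).not_ge (le_mul_of_one_le_right (norm_nonneg _) hge)
    have hflt : ∀ k, ‖f.coeff k‖ < 1 := fun k => by
      rw [show f.coeff k = (f.coeff k - V * g.coeff k) + V * g.coeff k by ring]
      refine (IsUltrametricDist.norm_add_le_max _ _).trans_lt
        (max_lt ((hcoeff hρ0 hρ1 hV k).trans_lt hκ) ?_)
      rw [norm_mul]
      exact mul_lt_one_of_nonneg_of_lt_one_left (norm_nonneg _) (hV ▸ hlt1 hρ0) (hg1 k)
    obtain ⟨k, hk | hk⟩ := hfg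
    · exact (hflt k).ne hk
    · exact (hglt k).ne hk

lemma max_rpow_eq {Q : ℝ} (hQ0 : 0 < Q) (hQ1 : Q < 1) (a b : ℝ) :
    max (Q ^ a) (Q ^ b) = Q ^ min a b :=
  ((Real.antitone_rpow_of_base_le_one hQ0 hQ1.le).map_min).symm

lemma prod_max_fibreNorms {q : L} (hq0 : q ≠ 0) (hq1 : ‖q‖ < 1) {m : ℕ} (hm : 0 < m) {σ ρ : ℚ}
    (hσ0 : 0 < σ) (hσ1 : σ < 1 / 2) (hρ0 : 0 < ρ) (hρ1 : ρ < 1 / 2) (hσρ : σ < ρ) :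
    ((fibreNorms q m σ).map fun r => ((fibreNorms q m ρ).map (max r)).prod).prod =
      ‖q‖ ^ ((m : ℝ) ^ 2 * (σ + ((m : ℝ) ^ 2 - 1) / 6)) := by
  have hQ0 : 0 < ‖q‖ := norm_pos_iff.mpr hq0
  have hm' : (m : ℝ) ≠ 0 := by exact_mod_cast hm.ne'
  have h2m : (0 : ℝ) ≤ 2 * m := by positivity
  have hsum := congrArg (Rat.cast : ℚ → ℝ) (sum_min_foldPoint hσ0 hσ1 hρ0 hρ1 hσρ m)
  push_cast at hsum
  have hmax : ∀ i j : ℕ, max (‖q‖ ^ ((foldPoint σ i / (2 * m) : ℚ) : ℝ))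
      (‖q‖ ^ ((foldPoint ρ j / (2 * m) : ℚ) : ℝ)) ^ m =
      ‖q‖ ^ (min (foldPoint σ i : ℝ) (foldPoint ρ j) / 2) := fun i j => by
    rw [max_rpow_eq hQ0 hq1, ← Real.rpow_natCast, ← Real.rpow_mul hQ0.le]
    push_cast
    rw [min_div_div_right h2m]
    congr 1
    field_simp
  simp only [prod_map_fibreNorms, hmax]
  have hprod : ∀ i ∈ Finset.range m, (∏ j ∈ Finset.range m,
      ‖q‖ ^ (min (foldPoint σ i : ℝ) (foldPoint ρ j) / 2)) ^ m =
      ‖q‖ ^ ((∑ j ∈ Finset.range m, min (foldPoint σ i : ℝ) (foldPoint ρ j)) * (m / 2)) :=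
    fun i _ => by
      rw [← Real.rpow_sum_of_pos hQ0, ← Finset.sum_div, ← Real.rpow_natCast,
        ← Real.rpow_mul hQ0.le]
      congr 1; ring
  rw [Finset.prod_congr rfl hprod, ← Real.rpow_sum_of_pos hQ0, ← Finset.sum_mul, hsum]
  congr 1; ring

lemma norm_resultant_of_foldedAbs [IsAlgClosed L] [IsUltrametricDist L] {q : L} (hq0 : q ≠ 0)
    (hq1 : ‖q‖ < 1) {m : ℕ} (hm : 0 < m) {f g : Polynomial L} (H : FoldedAbs q m f g)
    (hf : f.natDegree ≤ m ^ 2) (hg : g.natDegree ≤ m ^ 2)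
    (hf1 : ∀ k, ‖f.coeff k‖ ≤ 1) (hg1 : ∀ k, ‖g.coeff k‖ ≤ 1)
    (hfg : ∃ k, ‖f.coeff k‖ = 1 ∨ ‖g.coeff k‖ = 1) :
    ‖Polynomial.resultant f g (m ^ 2) (m ^ 2)‖ =
      ‖q‖ ^ ((m : ℝ) ^ 2 * ((m : ℝ) ^ 2 - 1) / 6) := by
  have hQ0 : 0 < ‖q‖ := norm_pos_iff.mpr hq0
  obtain ⟨σ, ρ, hσ0, hσρ, hρ1⟩ : ∃ σ ρ : ℚ, 0 < σ ∧ σ < ρ ∧ ρ < 1 / 2 :=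
    ⟨1 / 8, 1 / 4, by norm_num, by norm_num, by norm_num⟩
  have hσ1 := hσρ.trans hρ1
  have hρ0 := hσ0.trans hσρ
  obtain ⟨U, -, hU⟩ := exists_norm_eq_rpow hq0 σ
  obtain ⟨V, -, hV⟩ := exists_norm_eq_rpow hq0 ρ
  have hVU : ‖V‖ < ‖U‖ := by
    rw [hU, hV]
    exact Real.rpow_lt_rpow_of_exponent_gt hQ0 hq1 (by exact_mod_cast hσρ)
  obtain ⟨hA, hAd⟩ := norm_roots_eq_fibreNorms hq0 hq1 H hf hg hσ0 hσ1 hU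
  obtain ⟨hB, hBd⟩ := norm_roots_eq_fibreNorms hq0 hq1 H hf hg hρ0 hρ1 hV
  have hdisj : ∀ r ∈ fibreNorms q m σ, r ∉ fibreNorms q m ρ := by
    intro r hr hr'
    obtain ⟨i, -, rfl⟩ := mem_fibreNorms hr
    obtain ⟨j, -, h⟩ := mem_fibreNorms hr'
    rw [Real.rpow_right_inj hQ0 hq1.ne, Rat.cast_inj, div_left_inj' (by positivity)] at h
    exact foldPoint_ne hσ0 hσ1 hρ0 hρ1 hσρ i j h
  have h := norm_resultant_eq_prod hAd hBd (by rwa [hA, hB])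
  rw [hA, hB, prod_max_fibreNorms hq0 hq1 hm hσ0 hσ1 hρ0 hρ1 hσρ,
    norm_leadingCoeff_eq_one hq0 hq1 hm H hf hg hf1 hg1 hfg hσ0 hσ1 hU,
    norm_leadingCoeff_eq_one hq0 hq1 hm H hf hg hf1 hg1 hfg hρ0 hρ1 hV,
    resultant_sub_C_mul hf hg, norm_mul, norm_pow, norm_sub_eq_max_norm hVU.ne',
    max_eq_left hVU.le, hU, one_pow, one_mul, one_mul, mul_add, Real.rpow_add hQ0,
    ← Real.rpow_natCast, ← Real.rpow_mul hQ0.le, Nat.cast_pow, mul_comm (σ : ℝ)] at h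
  rw [mul_left_cancel₀ (Real.rpow_pos_of_pos hQ0 _).ne' h, mul_div_assoc]

end

/-- Assume `char K ∉ {2,3}` and the residue field has characteristic `∉ {2,3}`.
Let `0 < |q| < 1`, `m ≥ 2`, and let `ψ_m` (with normalized lift `[F,G]` of degree `m²`) be a
Lattès map for multiplication-by-`m` on the Tate curve with parameter `q`, i.e.
`ψ_m(x(w)) = x(w^m)` for the relevant `w`. Then `R_{ψ_m} = (m²(m²−1)/6) · ord(q)`. -/
theorem lattes_resultant {K : Type} [NontriviallyNormedField K] [IsAlgClosed K]
    [CompleteSpace K] [IsUltrametricDist K]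
    (hK2 : ringChar K ≠ 2) (hK3 : ringChar K ≠ 3)
    (hk2 : ringChar (kk K) ≠ 2) (hk3 : ringChar (kk K) ≠ 3)
    (q : K) (hq0 : q ≠ 0) (hq1 : ‖q‖ < 1) (m : ℕ) (hm : 2 ≤ m)
    (F G : MvPolynomial (Fin 2) K) (hlift : LiftPair K (m ^ 2) F G)
    (hnorm : Normalized K F G)
    (hsemi : ∀ w : K, w ≠ 0 → (∀ n : ℤ, w ≠ q ^ n) → (∀ n : ℤ, w ^ m ≠ q ^ n) →
      MvPolynomial.eval ![xTate K q w, 1] G ≠ 0 ∧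
      MvPolynomial.eval ![xTate K q w, 1] F =
        xTate K q (w ^ m) * MvPolynomial.eval ![xTate K q w, 1] G) :
    Rpair K (m ^ 2) F G = ((m : ℝ) ^ 2 * ((m : ℝ) ^ 2 - 1) / 6) * ordv K q := by
  obtain ⟨f, hf, rfl⟩ := exists_homogenize_eq hlift.1
  obtain ⟨g, hg, rfl⟩ := exists_homogenize_eq hlift.2.1
  have hm0 : 0 < m := by omega
  have hcoeff : ∀ {p : Polynomial K}, p.natDegree ≤ m ^ 2 →
      (∀ e, ‖(p.homogenize (m ^ 2)).coeff e‖ ≤ 1) → ∀ k, ‖p.coeff k‖ ≤ 1 := fun {p} hp h k => by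
    rcases le_or_gt k (m ^ 2) with hk | hk
    · have := h (Finsupp.single 0 k + Finsupp.single 1 (m ^ 2 - k))
      rw [Polynomial.coeff_homogenize] at this
      simpa [hk] using this
    · rw [Polynomial.coeff_eq_zero_of_natDegree_lt (hp.trans_lt hk), norm_zero]
      exact zero_le_one
  have hex : ∃ k, ‖f.coeff k‖ = 1 ∨ ‖g.coeff k‖ = 1 := by
    obtain ⟨e, he⟩ := hnorm.2.2
    rw [Polynomial.coeff_homogenize, Polynomial.coeff_homogenize] at he
    split_ifs at he
    · exact ⟨_, he⟩
    · simp at he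
  have hres := norm_resultant_of_foldedAbs hq0 hq1 hm0
    (foldedAbs_of_semiconj hq0 hq1 hm0 hf hg hsemi) hf hg (hcoeff hf hnorm.1)
    (hcoeff hg hnorm.2.1) hex
  rw [Rpair, maxNorm_homogenize_eq_one hnorm, Real.log_one, mul_zero, add_zero, ordv, ordv,
    bres_homogenize, hres, Real.log_rpow (norm_pos_iff.mpr hq0), mul_neg]

end
end
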